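/- arXiv:1902.06041 — 2 statements merged into one kernel-verified Lean document; each statement's English description precedes it below -/
import Mathlib

section
/- There exists a real number R > 0 such that for every t ≥ R the set S ∩ {x ∈ ℝ^n : ‖x‖ = t} is nonempty (hence nonempty and compact). -/
open Filter

noncomputable section

def IsPolyFun {n : ℕ} (f : EuclideanSpace ℝ (Fin n) → ℝ) : Prop :=
  ∃ P : MvPolynomial (Fin n) ℝ, ∀ x, f x = MvPolynomial.eval (fun i => x i) P

def conSet {n l m : ℕ} (g : Fin l → EuclideanSpace ℝ (Fin n) → ℝ)
    (h : Fin m → EuclideanSpace ℝ (Fin n) → ℝ) : Set (EuclideanSpace ℝ (Fin n)) :=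
  {x | (∀ i, g i x = 0) ∧ (∀ j, 0 ≤ h j x)}

def LICQ {n l m : ℕ} (g : Fin l → EuclideanSpace ℝ (Fin n) → ℝ)
    (h : Fin m → EuclideanSpace ℝ (Fin n) → ℝ) : Prop :=
  ∀ x ∈ conSet g h, LinearIndependent ℝ
    (Sum.elim (fun i : Fin l => gradient (g i) x)
      (fun j : {j : Fin m // h j x = 0} => gradient (h j.1) x))

def criticalSet {n l m : ℕ} (f : EuclideanSpace ℝ (Fin n) → ℝ)
    (g : Fin l → EuclideanSpace ℝ (Fin n) → ℝ)
    (h : Fin m → EuclideanSpace ℝ (Fin n) → ℝ) : Set (EuclideanSpace ℝ (Fin n)) :=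
  {x | x ∈ conSet g h ∧ ∃ (lam : Fin l → ℝ) (nu : Fin m → ℝ),
    gradient f x - ∑ i, lam i • gradient (g i) x - ∑ j, nu j • gradient (h j) x = 0 ∧
    ∀ j, nu j * h j x = 0}

def tangencySet {n l m : ℕ} (f : EuclideanSpace ℝ (Fin n) → ℝ)
    (g : Fin l → EuclideanSpace ℝ (Fin n) → ℝ)
    (h : Fin m → EuclideanSpace ℝ (Fin n) → ℝ) : Set (EuclideanSpace ℝ (Fin n)) :=
  {x | x ∈ conSet g h ∧ ∃ (κ : ℝ) (lam : Fin l → ℝ) (nu : Fin m → ℝ) (μ : ℝ),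
    (κ, lam, nu, μ) ≠ 0 ∧
    κ • gradient f x - ∑ i, lam i • gradient (g i) x - ∑ j, nu j • gradient (h j) x - μ • x = 0 ∧
    ∀ j, nu j * h j x = 0}

def tangencyValues {n l m : ℕ} (f : EuclideanSpace ℝ (Fin n) → ℝ)
    (g : Fin l → EuclideanSpace ℝ (Fin n) → ℝ)
    (h : Fin m → EuclideanSpace ℝ (Fin n) → ℝ) : Set ℝ :=
  {lam | ∃ x : ℕ → EuclideanSpace ℝ (Fin n), (∀ k, x k ∈ tangencySet f g h) ∧
    Tendsto (fun k => ‖x k‖) atTop atTop ∧ Tendsto (fun k => f (x k)) atTop (nhds lam)}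

def psi {n l m : ℕ} (f : EuclideanSpace ℝ (Fin n) → ℝ)
    (g : Fin l → EuclideanSpace ℝ (Fin n) → ℝ)
    (h : Fin m → EuclideanSpace ℝ (Fin n) → ℝ) (t : ℝ) : EReal :=
  sInf ((fun x => (f x : EReal)) '' {x | x ∈ conSet g h ∧ ‖x‖ = t})

def CoerciveOn {n : ℕ} (f : EuclideanSpace ℝ (Fin n) → ℝ)
    (S : Set (EuclideanSpace ℝ (Fin n))) : Prop :=
  ∀ x : ℕ → EuclideanSpace ℝ (Fin n), (∀ k, x k ∈ S) →
    Tendsto (fun k => ‖x k‖) atTop atTop → Tendsto (fun k => f (x k)) atTop atTop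

lemma Polynomial.sign_eval_eq_of_forall_ne_zero (p : Polynomial ℝ) {u v : ℝ}
    (h : ∀ y ∈ Set.uIcc u v, p.eval y ≠ 0) :
    SignType.sign (p.eval u) = SignType.sign (p.eval v) := by
  have hz : (0 : ℝ) ∉ Set.uIcc (p.eval u) (p.eval v) := by
    intro h0
    obtain ⟨y, hy, hy0⟩ := intermediate_value_uIcc (p.continuous.continuousOn) h0
    exact h y hy hy0
  have hu := h u Set.left_mem_uIcc
  have hv := h v Set.right_mem_uIcc
  rw [Set.mem_uIcc] at hz
  push Not at hz
  rcases lt_or_gt_of_ne hu with hu | hu <;> rcases lt_or_gt_of_ne hv with hv | hv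
  · rw [sign_neg hu, sign_neg hv]
  · exact absurd hv (hz.1 hu.le).not_gt
  · exact absurd hu (hz.2 hv.le).not_gt
  · rw [sign_pos hu, sign_pos hv]

lemma Polynomial.exists_derivative_eval_eq_zero (p : Polynomial ℝ) {a b : ℝ} (hab : a < b)
    (h : p.eval a = p.eval b) : ∃ c ∈ Set.Ioo a b, p.derivative.eval c = 0 :=
  exists_hasDerivAt_eq_zero hab p.continuous.continuousOn h fun x _ => p.hasDerivAt x

lemma Polynomial.eventually_sign_eval_eq (p : Polynomial ℝ) :
    ∀ᶠ y in atTop, SignType.sign (p.eval y) = SignType.sign p.leadingCoeff := by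
  rcases le_or_gt p.degree 0 with hd | hd
  · rw [Polynomial.eq_C_of_degree_le_zero hd]
    simp
  · have hp : p ≠ 0 := by rintro rfl; simp at hd
    rcases lt_or_gt_of_ne (leadingCoeff_ne_zero.2 hp) with h | h
    · filter_upwards [(p.tendsto_atBot_of_leadingCoeff_nonpos hd h.le).eventually_lt_atBot 0]
        with y hy
      rw [sign_neg hy, sign_neg h]
    · filter_upwards [(p.tendsto_atTop_of_leadingCoeff_nonneg hd h.le).eventually_gt_atTop 0]
        with y hy
      rw [sign_pos hy, sign_pos h]

lemma Polynomial.eventually_atBot_sign_eval_eq (p : Polynomial ℝ) :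
    ∀ᶠ y in atBot, SignType.sign (p.eval y) =
      SignType.sign (p.leadingCoeff * (-1) ^ p.natDegree) := by
  have h := tendsto_neg_atBot_atTop.eventually (p.comp (-X)).eventually_sign_eval_eq
  filter_upwards [h] with y hy
  rw [leadingCoeff_comp (by simp)] at hy
  simpa using hy

lemma exists_orderIso_eqOn (S : Finset ℝ) (f : ℝ → ℝ) (hf : StrictMonoOn f S) :
    ∃ ψ : ℝ ≃o ℝ, ∀ x ∈ S, ψ x = f x := by
  induction S using Finset.induction_on_max with
  | empty => exact ⟨OrderIso.refl ℝ, by simp⟩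
  | insert a S ha ih =>
    obtain ⟨ψ, hψ⟩ := ih (hf.mono (by simp))
    rcases S.eq_empty_or_nonempty with rfl | hne
    · exact ⟨OrderIso.addRight (f a - a), by simp⟩
    set u := S.max' hne
    have huS : u ∈ S := S.max'_mem hne
    have hu : ψ u = f u := hψ u huS
    have hua : u < a := ha u huS
    have h1 : 0 < f a - f u := sub_pos.2 (hf (by simp [huS]) (by simp) hua)
    have h2 : 0 < ψ a - f u := by rw [← hu]; exact sub_pos.2 (ψ.strictMono hua)
    set c := (f a - f u) / (ψ a - f u) with hc
    have hcpos : 0 < c := div_pos h1 h2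
    let θ : ℝ → ℝ := fun x => if x ≤ f u then x else f u + c * (x - f u)
    have hθ : StrictMono θ := by
      intro x y hxy
      simp only [θ]
      split_ifs with hx hy hy
      · exact hxy
      · have := mul_pos hcpos (sub_pos.2 (not_le.1 hy))
        linarith
      · linarith
      · have := mul_lt_mul_of_pos_left hxy hcpos
        linarith
    have hθs : Function.Surjective θ := by
      intro y
      by_cases hy : y ≤ f u
      · exact ⟨y, if_pos hy⟩
      · have h3 : 0 < (y - f u) / c := div_pos (sub_pos.2 (not_le.1 hy)) hcpos
        refine ⟨f u + (y - f u) / c, ?_⟩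
        simp only [θ]
        rw [if_neg (by linarith)]
        field_simp
        ring
    refine ⟨ψ.trans (hθ.orderIsoOfSurjective θ hθs), fun x hx => ?_⟩
    simp only [OrderIso.trans_apply, StrictMono.coe_orderIsoOfSurjective]
    rcases Finset.mem_insert.1 hx with rfl | hx
    · simp only [θ]
      rw [if_neg (by linarith), hc]
      field_simp
      ring
    · have : f x ≤ f u := by
        rw [← hψ x hx, ← hu]
        exact ψ.monotone (S.le_max' x hx)
      simp only [θ]
      rw [hψ x hx, if_pos this]

lemma Polynomial.exists_root_same_cut {p q : Polynomial ℝ} (φ : ℝ ≃o ℝ) (D : Finset ℝ)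
    (hD : ∀ y, p.derivative.eval y = 0 → y ∈ D)
    (hs : ∀ z ∈ D, SignType.sign (p.eval z) = SignType.sign (q.eval (φ z)))
    {α : ℝ} (hα : p.eval α = 0) (hlo : ∃ z ∈ D, z < α) (hhi : ∃ z ∈ D, α < z) :
    ∃ β, q.eval β = 0 ∧ ∀ z ∈ D, (z < α → φ z < β) ∧ (α < z → β < φ z) ∧ (z = α → φ z = β) := by
  by_cases hαD : α ∈ D
  · refine ⟨φ α, ?_, fun z _ => ⟨fun h => φ.strictMono h, fun h => φ.strictMono h, congrArg φ⟩⟩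
    have := hs α hαD
    rw [hα, sign_zero] at this
    exact sign_eq_zero_iff.1 this.symm
  have hlo' : (D.filter (· < α)).Nonempty := by
    obtain ⟨z, hz, h⟩ := hlo; exact ⟨z, by simp [hz, h]⟩
  have hhi' : (D.filter (α < ·)).Nonempty := by
    obtain ⟨z, hz, h⟩ := hhi; exact ⟨z, by simp [hz, h]⟩
  obtain ⟨a, ha, hamax⟩ : ∃ a ∈ D.filter (· < α), ∀ z ∈ D.filter (· < α), z ≤ a :=
    ⟨_, Finset.max'_mem _ hlo', fun z hz => Finset.le_max' _ z hz⟩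
  obtain ⟨b, hb, hbmin⟩ : ∃ b ∈ D.filter (α < ·), ∀ z ∈ D.filter (α < ·), b ≤ z :=
    ⟨_, Finset.min'_mem _ hhi', fun z hz => Finset.min'_le _ z hz⟩
  rw [Finset.mem_filter] at ha hb
  have hno : ∀ z ∈ D, ¬ (a < z ∧ z < b) := by
    rintro z hz ⟨h1, h2⟩
    rcases lt_trichotomy z α with h | h | h
    · exact absurd (hamax z (by simp [hz, h])) h1.not_ge
    · exact hαD (h ▸ hz)
    · exact absurd (hbmin z (by simp [hz, h])) h2.not_ge
  have hab : a < b := ha.2.trans hb.2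
  have hinj : Set.InjOn (fun y => p.eval y) (Set.Icc a b) := by
    intro x hx y hy hxy
    by_contra hne
    wlog hlt : x < y generalizing x y
    · exact this hy hx hxy.symm (Ne.symm hne) (lt_of_le_of_ne (not_lt.1 hlt) (Ne.symm hne))
    obtain ⟨c, hc, hc0⟩ := p.exists_derivative_eval_eq_zero hlt hxy
    exact hno c (hD c hc0) ⟨hx.1.trans_lt hc.1, hc.2.trans_le hy.2⟩
  have hαm : α ∈ Set.Icc a b := ⟨ha.2.le, hb.2.le⟩
  have ham : a ∈ Set.Icc a b := ⟨le_rfl, hab.le⟩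
  have hbm : b ∈ Set.Icc a b := ⟨hab.le, le_rfl⟩
  have key : ∃ β ∈ Set.Ioo (φ a) (φ b), q.eval β = 0 := by
    have hφ := (φ.strictMono hab).le
    have hsa := hs a ha.1
    have hsb := hs b hb.1
    rcases p.continuous.continuousOn.strictMonoOn_of_injOn_Icc' hab.le hinj with hm | hm
    · have h1 : p.eval a < 0 := hα ▸ hm ham hαm ha.2
      have h2 : 0 < p.eval b := hα ▸ hm hαm hbm hb.2
      rw [sign_neg h1, eq_comm, sign_eq_neg_one_iff] at hsa
      rw [sign_pos h2, eq_comm, sign_eq_one_iff] at hsb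
      exact intermediate_value_Ioo hφ q.continuous.continuousOn ⟨hsa, hsb⟩
    · have h1 : 0 < p.eval a := hα ▸ hm ham hαm ha.2
      have h2 : p.eval b < 0 := hα ▸ hm hαm hbm hb.2
      rw [sign_pos h1, eq_comm, sign_eq_one_iff] at hsa
      rw [sign_neg h2, eq_comm, sign_eq_neg_one_iff] at hsb
      exact intermediate_value_Ioo' hφ q.continuous.continuousOn ⟨hsb, hsa⟩
  obtain ⟨β, hβ, hβ0⟩ := key
  refine ⟨β, hβ0, fun z hz => ⟨fun h => ?_, fun h => ?_, fun h => absurd (h ▸ hz) hαD⟩⟩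
  · exact (φ.monotone (hamax z (by simp [hz, h]))).trans_lt hβ.1
  · exact hβ.2.trans_le (φ.monotone (hbmin z (by simp [hz, h])))

lemma Polynomial.exists_mem_forall_uIcc_eval_ne_zero {p : Polynomial ℝ} (hp : p ≠ 0)
    (D : Finset ℝ) (hD : ∀ y, p.derivative.eval y = 0 → y ∈ D)
    (hlo : ∃ z ∈ D, ∀ y, p.eval y = 0 → z < y) (hhi : ∃ z ∈ D, ∀ y, p.eval y = 0 → y < z)
    {y : ℝ} (hy : p.eval y ≠ 0) : ∃ z ∈ D, ∀ w ∈ Set.uIcc z y, p.eval w ≠ 0 := by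
  have hroot : ∀ w, w ∈ p.roots.toFinset ↔ p.eval w = 0 := by simp [hp]
  by_cases h1 : (p.roots.toFinset.filter (· < y)).Nonempty
  swap
  · obtain ⟨z, hz, hzr⟩ := hlo
    refine ⟨z, hz, fun w hw h0 => ?_⟩
    have h2 := hzr w h0
    rcases Set.mem_uIcc.1 hw with h | h
    · refine h1 ⟨w, Finset.mem_filter.2 ⟨(hroot w).2 h0, h.2.lt_of_ne ?_⟩⟩
      rintro rfl; exact hy h0
    · exact absurd h2 h.2.not_gt
  by_cases h2 : (p.roots.toFinset.filter (y < ·)).Nonempty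
  swap
  · obtain ⟨z, hz, hzr⟩ := hhi
    refine ⟨z, hz, fun w hw h0 => ?_⟩
    have h3 := hzr w h0
    rcases Set.mem_uIcc.1 hw with h | h
    · exact absurd h3 h.1.not_gt
    · refine h2 ⟨w, Finset.mem_filter.2 ⟨(hroot w).2 h0, h.1.lt_of_ne ?_⟩⟩
      rintro rfl; exact hy h0
  obtain ⟨a, ha, hamax⟩ : ∃ a ∈ p.roots.toFinset.filter (· < y),
      ∀ z ∈ p.roots.toFinset.filter (· < y), z ≤ a :=
    ⟨_, Finset.max'_mem _ h1, fun z hz => Finset.le_max' _ z hz⟩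
  obtain ⟨b, hb, hbmin⟩ : ∃ b ∈ p.roots.toFinset.filter (y < ·),
      ∀ z ∈ p.roots.toFinset.filter (y < ·), b ≤ z :=
    ⟨_, Finset.min'_mem _ h2, fun z hz => Finset.min'_le _ z hz⟩
  rw [Finset.mem_filter, hroot] at ha hb
  obtain ⟨c, hc, hc0⟩ := p.exists_derivative_eval_eq_zero (ha.2.trans hb.2) (ha.1.trans hb.1.symm)
  refine ⟨c, hD c hc0, fun w hw h0 => ?_⟩
  rw [Set.mem_uIcc] at hw
  rcases lt_trichotomy w y with h | h | h
  · have := hamax w (Finset.mem_filter.2 ⟨(hroot w).2 h0, h⟩)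
    rcases hw with hw | hw
    · linarith [hc.1]
    · linarith
  · exact hy (h ▸ h0)
  · have := hbmin w (Finset.mem_filter.2 ⟨(hroot w).2 h0, h⟩)
    rcases hw with hw | hw
    · linarith
    · linarith [hc.2]

lemma exists_orderIso_sign_eval_of_cuts {p q : Polynomial ℝ} (hp : p ≠ 0) (φ : ℝ ≃o ℝ)
    (D : Finset ℝ) (hDp : ∀ y, p.derivative.eval y = 0 → y ∈ D)
    (hDq : ∀ y, q.derivative.eval y = 0 → φ.symm y ∈ D)
    (hs : ∀ z ∈ D, SignType.sign (p.eval z) = SignType.sign (q.eval (φ z)))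
    (hlo : ∃ z ∈ D, (∀ y, p.eval y = 0 → z < y) ∧ ∀ y, q.eval y = 0 → φ z < y)
    (hhi : ∃ z ∈ D, (∀ y, p.eval y = 0 → y < z) ∧ ∀ y, q.eval y = 0 → y < φ z) :
    ∃ ψ : ℝ ≃o ℝ, (∀ z ∈ D, ψ z = φ z) ∧
      ∀ y, SignType.sign (p.eval y) = SignType.sign (q.eval (ψ y)) := by
  classical
  obtain ⟨lo, hloD, hlop, hloq⟩ := hlo
  obtain ⟨hi, hhiD, hhip, hhiq⟩ := hhi
  have hex : ∀ α, p.eval α = 0 → ∃ β, q.eval β = 0 ∧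
      ∀ z ∈ D, (z < α → φ z < β) ∧ (α < z → β < φ z) ∧ (z = α → φ z = β) := fun α hα =>
    Polynomial.exists_root_same_cut φ D hDp hs hα ⟨lo, hloD, hlop α hα⟩ ⟨hi, hhiD, hhip α hα⟩
  choose! β hβ hcut using hex
  have hex' : ∀ w, q.eval w = 0 → ∃ α, p.eval α = 0 ∧
      ∀ z ∈ D, (φ z < w → z < α) ∧ (w < φ z → α < z) := by
    intro w hw
    obtain ⟨α, hα, h⟩ := Polynomial.exists_root_same_cut (p := q) (q := p) φ.symm (D.image φ)
      (fun y hy => Finset.mem_image.2 ⟨_, hDq y hy, φ.apply_symm_apply y⟩)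
      (fun z hz => by
        obtain ⟨x, hx, rfl⟩ := Finset.mem_image.1 hz
        rw [φ.symm_apply_apply, hs x hx]) hw
      ⟨_, Finset.mem_image_of_mem _ hloD, hloq w hw⟩ ⟨_, Finset.mem_image_of_mem _ hhiD, hhiq w hw⟩
    refine ⟨α, hα, fun z hz => ?_⟩
    have := h _ (Finset.mem_image_of_mem φ hz)
    rw [φ.symm_apply_apply] at this
    exact ⟨this.1, this.2.1⟩
  let f : ℝ → ℝ := fun y => if p.eval y = 0 then β y else φ y
  have hfR : ∀ y, p.eval y = 0 → f y = β y := fun y hy => if_pos hy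
  have hfD : ∀ y ∈ D, f y = φ y := by
    intro y hy
    by_cases h : p.eval y = 0
    · rw [hfR y h]
      exact ((hcut y h y hy).2.2 rfl).symm
    · exact if_neg h
  have hf : StrictMonoOn f (D ∪ p.roots.toFinset : Finset ℝ) := by
    intro x hx y hy hxy
    simp only [Finset.coe_union, Set.mem_union, Finset.mem_coe, Multiset.mem_toFinset,
      Polynomial.mem_roots hp, Polynomial.IsRoot.def] at hx hy
    rcases hx with hx | hx <;> rcases hy with hy | hy
    · rw [hfD x hx, hfD y hy]
      exact φ.strictMono hxy
    · rw [hfD x hx, hfR y hy]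
      exact (hcut y hy x hx).1 hxy
    · rw [hfR x hx, hfD y hy]
      exact (hcut x hx y hy).2.1 hxy
    · obtain ⟨c, hc, hc0⟩ := p.exists_derivative_eval_eq_zero hxy (hx.trans hy.symm)
      rw [hfR x hx, hfR y hy]
      exact ((hcut x hx c (hDp c hc0)).2.1 hc.1).trans ((hcut y hy c (hDp c hc0)).1 hc.2)
  obtain ⟨ψ, hψ⟩ := exists_orderIso_eqOn _ f hf
  have hψD : ∀ z ∈ D, ψ z = φ z := fun z hz => by
    rw [hψ z (Finset.mem_union_left _ hz), hfD z hz]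
  have hψR : ∀ y, p.eval y = 0 → ψ y = β y := fun y hy => by
    rw [hψ y (Finset.mem_union_right _ (by simp [hp, hy])), hfR y hy]
  have hback : ∀ w, q.eval w = 0 → p.eval (ψ.symm w) = 0 := by
    intro w hw
    obtain ⟨α, hα, hc⟩ := hex' w hw
    suffices ψ α = w by rw [← this, ψ.symm_apply_apply, hα]
    rw [hψR α hα]
    rcases lt_trichotomy (β α) w with h | h | h
    · obtain ⟨c, hc', hc0⟩ := q.exists_derivative_eval_eq_zero h ((hβ α hα).trans hw.symm)
      have hz := hDq c hc0
      have h1 := (hc _ hz).1 (by simpa using hc'.2)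
      have h2 := (hcut α hα _ hz).1 h1
      rw [φ.apply_symm_apply] at h2
      exact absurd h2 hc'.1.not_gt
    · exact h
    · obtain ⟨c, hc', hc0⟩ := q.exists_derivative_eval_eq_zero h (hw.trans (hβ α hα).symm)
      have hz := hDq c hc0
      have h1 := (hc _ hz).2 (by simpa using hc'.1)
      have h2 := (hcut α hα _ hz).2.1 h1
      rw [φ.apply_symm_apply] at h2
      exact absurd h2 hc'.2.not_gt
  refine ⟨ψ, hψD, fun y => ?_⟩
  by_cases hy : p.eval y = 0
  · rw [hψR y hy, hβ y hy, hy]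
  · obtain ⟨z, hz, hzy⟩ := Polynomial.exists_mem_forall_uIcc_eval_ne_zero hp D hDp
      ⟨lo, hloD, hlop⟩ ⟨hi, hhiD, hhip⟩ hy
    rw [← p.sign_eval_eq_of_forall_ne_zero hzy, hs z hz, ← hψD z hz]
    refine q.sign_eval_eq_of_forall_ne_zero fun w hw h0 => hzy (ψ.symm w) ?_ (hback w h0)
    rw [Set.mem_uIcc] at hw ⊢
    simpa only [ψ.le_symm_apply, ψ.symm_apply_le] using hw

lemma exists_orderIso_sign_eval {p q : Polynomial ℝ} (hp : p ≠ 0) (hq : q ≠ 0)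
    (hdeg : p.natDegree = q.natDegree)
    (hlead : SignType.sign p.leadingCoeff = SignType.sign q.leadingCoeff) (φ : ℝ ≃o ℝ)
    (Z : Finset ℝ) (hZp : ∀ y, p.derivative.eval y = 0 → y ∈ Z)
    (hZq : ∀ y, q.derivative.eval y = 0 → φ.symm y ∈ Z)
    (hs : ∀ z ∈ Z, SignType.sign (p.eval z) = SignType.sign (q.eval (φ z))) :
    ∃ ψ : ℝ ≃o ℝ, (∀ z ∈ Z, ψ z = φ z) ∧
      ∀ y, SignType.sign (p.eval y) = SignType.sign (q.eval (ψ y)) := by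
  classical
  have hlo : ∃ z, SignType.sign (p.eval z) = SignType.sign (q.eval (φ z)) ∧
      (∀ y, p.eval y = 0 → z < y) ∧ ∀ y, q.eval y = 0 → φ z < y := by
    have h1 : ∀ᶠ z : ℝ in atBot, ∀ y ∈ p.roots.toFinset, z < y :=
      (Finset.eventually_all _).2 fun y _ => eventually_lt_atBot y
    have h2 : ∀ᶠ z : ℝ in atBot, ∀ y ∈ q.roots.toFinset, z < y :=
      (Finset.eventually_all _).2 fun y _ => eventually_lt_atBot y
    obtain ⟨z, h1, h2, h3, h4⟩ := (h1.and ((φ.tendsto_atBot.eventually h2).and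
      (p.eventually_atBot_sign_eval_eq.and
        (φ.tendsto_atBot.eventually q.eventually_atBot_sign_eval_eq)))).exists
    refine ⟨z, ?_, fun y hy => h1 y (by simp [hp, hy]), fun y hy => h2 y (by simp [hq, hy])⟩
    rw [h3, h4, sign_mul, sign_mul, hlead, hdeg]
  have hhi : ∃ z, SignType.sign (p.eval z) = SignType.sign (q.eval (φ z)) ∧
      (∀ y, p.eval y = 0 → y < z) ∧ ∀ y, q.eval y = 0 → y < φ z := by
    have h1 : ∀ᶠ z : ℝ in atTop, ∀ y ∈ p.roots.toFinset, y < z :=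
      (Finset.eventually_all _).2 fun y _ => eventually_gt_atTop y
    have h2 : ∀ᶠ z : ℝ in atTop, ∀ y ∈ q.roots.toFinset, y < z :=
      (Finset.eventually_all _).2 fun y _ => eventually_gt_atTop y
    obtain ⟨z, h1, h2, h3, h4⟩ := (h1.and ((φ.tendsto_atTop.eventually h2).and
      (p.eventually_sign_eval_eq.and
        (φ.tendsto_atTop.eventually q.eventually_sign_eval_eq)))).exists
    refine ⟨z, ?_, fun y hy => h1 y (by simp [hp, hy]), fun y hy => h2 y (by simp [hq, hy])⟩
    rw [h3, h4, hlead]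
  obtain ⟨lo, hlos, hlo⟩ := hlo
  obtain ⟨hi, hhis, hhi⟩ := hhi
  obtain ⟨ψ, hψ, h⟩ := exists_orderIso_sign_eval_of_cuts hp φ (insert lo (insert hi Z))
    (fun y hy => by simp [hZp y hy]) (fun y hy => by simp [hZq y hy])
    (by simpa [hlos, hhis] using hs) ⟨lo, by simp, hlo⟩ ⟨hi, by simp, hhi⟩
  exact ⟨ψ, fun z hz => hψ z (by simp [hz]), h⟩

lemma sign_eval_eq_of_orderIso_eqOn_roots {p q : Polynomial ℝ} {φ ψ : ℝ ≃o ℝ}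
    (h : ∀ y, SignType.sign (p.eval y) = SignType.sign (q.eval (φ y)))
    (hψ : ∀ z ∈ p.roots, ψ z = φ z) (y : ℝ) :
    SignType.sign (p.eval y) = SignType.sign (q.eval (ψ y)) := by
  by_cases hp : p = 0
  · have := h (φ.symm (ψ y))
    rw [φ.apply_symm_apply] at this
    rw [← this, hp, Polynomial.eval_zero, Polynomial.eval_zero]
  by_cases hy : p.eval y = 0
  · rw [hψ y (by simp [hp, hy]), h]
  rw [h]
  refine q.sign_eval_eq_of_forall_ne_zero fun w hw h0 => ?_
  have hz : p.eval (φ.symm w) = 0 := by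
    have := h (φ.symm w)
    rw [φ.apply_symm_apply, h0, sign_zero] at this
    exact sign_eq_zero_iff.1 this
  have hzw : ψ (φ.symm w) = w := by
    rw [hψ _ (by simp [hp, hz]), φ.apply_symm_apply]
  refine hy ?_
  suffices y = φ.symm w by rw [this, hz]
  rw [Set.mem_uIcc] at hw
  rcases hw with ⟨h1, h2⟩ | ⟨h1, h2⟩
  · exact le_antisymm (φ.le_symm_apply.2 h1) (ψ.le_iff_le.1 (hzw.trans_le h2))
  · exact le_antisymm (ψ.le_iff_le.1 (h1.trans_eq hzw.symm)) (φ.symm_apply_le.2 h2)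

open Polynomial in
lemma Polynomial.exists_pseudo_remainder {A : Type*} [CommRing A] (p q : A[X]) (k : ℕ)
    (hq : q.natDegree ≤ k) :
    ∃ (N : ℕ) (s r : A[X]), C (q.coeff k ^ N) * p = q * s + r ∧ r.degree < k := by
  obtain ⟨n, hn⟩ : ∃ n : ℕ, p.degree < (k + n : ℕ) :=
    ⟨p.natDegree + 1, degree_le_natDegree.trans_lt (by exact_mod_cast by omega)⟩
  induction n generalizing p with
  | zero => exact ⟨0, 0, p, by simp, by simpa using hn⟩
  | succ n ih =>
    set p' := C (q.coeff k) * p - q * (C (p.coeff (k + n)) * X ^ n) with hp'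
    have hdeg : p'.degree < (k + n : ℕ) := by
      rw [degree_lt_iff_coeff_zero]
      intro m hm
      rw [hp', coeff_sub, coeff_C_mul, ← mul_assoc, coeff_mul_X_pow', if_pos (by omega),
        coeff_mul_C]
      rcases hm.eq_or_lt with rfl | hm
      · rw [Nat.add_sub_cancel]; ring
      · have h1 : p.coeff m = 0 :=
          coeff_eq_zero_of_degree_lt (hn.trans_le (by exact_mod_cast by omega))
        have h2 : q.coeff (m - n) = 0 := coeff_eq_zero_of_natDegree_lt (by omega)
        rw [h1, h2]
        ring
    obtain ⟨N, s, r, h, hr⟩ := ih p' hdeg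
    refine ⟨N + 1, s + C (q.coeff k ^ N) * (C (p.coeff (k + n)) * X ^ n), r, ?_, hr⟩
    have : C (q.coeff k ^ (N + 1)) * p = C (q.coeff k ^ N) * p' +
        C (q.coeff k ^ N) * (q * (C (p.coeff (k + n)) * X ^ n)) := by
      rw [hp', pow_succ, C_mul]; ring
    rw [this, h]; ring

/-- The signs of finitely many elements of the coefficient ring determine the sign pattern of `G`
along the real line, up to an increasing reparametrization. -/
def HasSignLift {A : Type*} [CommRing A] (G : Finset (Polynomial A)) : Prop :=
  ∃ F : Finset A, ∀ σ τ : A →+* ℝ, (∀ a ∈ F, SignType.sign (σ a) = SignType.sign (τ a)) →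
    ∃ φ : ℝ ≃o ℝ, ∀ p ∈ G, ∀ y,
      SignType.sign ((p.map σ).eval y) = SignType.sign ((p.map τ).eval (φ y))

/-- The truncation of `q` to degree at most `k`. -/
def Polynomial.truncLE {A : Type*} [CommRing A] (q : Polynomial A) (k : ℕ) : Polynomial A :=
  ∑ i ∈ Finset.range (k + 1), Polynomial.monomial i (q.coeff i)

lemma Polynomial.coeff_truncLE {A : Type*} [CommRing A] (q : Polynomial A) (k m : ℕ) :
    (q.truncLE k).coeff m = if m ≤ k then q.coeff m else 0 := by
  simp [truncLE, Polynomial.coeff_monomial]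

lemma Polynomial.natDegree_truncLE_le {A : Type*} [CommRing A] (q : Polynomial A) (k : ℕ) :
    (q.truncLE k).natDegree ≤ k := by
  rw [natDegree_le_iff_coeff_eq_zero]
  intro m hm
  rw [coeff_truncLE, if_neg (by omega)]

open Polynomial in
lemma Polynomial.exists_truncRem {A : Type*} [CommRing A] (p q : A[X]) (k : ℕ) :
    ∃ r : A[X], r.degree < k ∧
      ∃ (N : ℕ) (s : A[X]), C (q.coeff k ^ N) * p = q.truncLE k * s + r := by
  obtain ⟨N, s, r, h, hr⟩ :=
    p.exists_pseudo_remainder (q.truncLE k) k (q.natDegree_truncLE_le k)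
  rw [coeff_truncLE, if_pos le_rfl] at h
  exact ⟨r, hr, N, s, h⟩

open Polynomial in
/-- A pseudo-remainder of `p` by the truncation of `q` to degree at most `k`. -/
def Polynomial.truncRem {A : Type*} [CommRing A] (p q : A[X]) (k : ℕ) : A[X] :=
  (p.exists_truncRem q k).choose

open Polynomial in
lemma sign_eval_eq_of_truncRem {A : Type*} [CommRing A] {σ τ : A →+* ℝ} {p q : A[X]}
    (hc : ∀ i, SignType.sign (σ (q.coeff i)) = SignType.sign (τ (q.coeff i)))
    (hq : q.map σ ≠ 0) {y z : ℝ} (hy : (q.map σ).eval y = 0) (hz : (q.map τ).eval z = 0)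
    (hr : ∀ k ≤ q.natDegree, SignType.sign (((p.truncRem q k).map σ).eval y) =
      SignType.sign (((p.truncRem q k).map τ).eval z)) :
    SignType.sign ((p.map σ).eval y) = SignType.sign ((p.map τ).eval z) := by
  set k := (q.map σ).natDegree with hk
  obtain ⟨N, s, h⟩ := (p.exists_truncRem q k).choose_spec.2
  change C (q.coeff k ^ N) * p = q.truncLE k * s + p.truncRem q k at h
  have hσ : (q.truncLE k).map σ = q.map σ := by
    ext i
    rw [coeff_map, coeff_truncLE]
    split_ifs with hi
    · rw [coeff_map]
    · rw [map_zero, coeff_eq_zero_of_natDegree_lt (by omega)]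
  have hτ : (q.truncLE k).map τ = q.map τ := by
    ext i
    rw [coeff_map, coeff_truncLE]
    split_ifs with hi
    · rw [coeff_map]
    · have h0 : (q.map σ).coeff i = 0 := coeff_eq_zero_of_natDegree_lt (by omega)
      have := hc i
      rw [coeff_map] at h0
      rw [h0, sign_zero, eq_comm, sign_eq_zero_iff] at this
      rw [map_zero, coeff_map, this]
  have h1 : σ (q.coeff k) ^ N * (p.map σ).eval y = ((p.truncRem q k).map σ).eval y := by
    have := congrArg (fun r => (r.map σ).eval y) h
    simpa [hσ, hy] using this
  have h2 : τ (q.coeff k) ^ N * (p.map τ).eval z = ((p.truncRem q k).map τ).eval z := by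
    have := congrArg (fun r => (r.map τ).eval z) h
    simpa [hτ, hz] using this
  have hk0 : SignType.sign (σ (q.coeff k)) ≠ 0 := by
    rw [Ne, sign_eq_zero_iff, ← coeff_map, hk]
    exact leadingCoeff_ne_zero.2 hq
  have h3 := hr k natDegree_map_le
  rw [← h1, ← h2, sign_mul, sign_mul, sign_pow, sign_pow, ← hc k] at h3
  exact mul_left_cancel₀ (pow_ne_zero N hk0) h3

open Polynomial in
/-- The polynomials of lower degree used to control the signs of `p` relative to those of `K`. -/
def hormanderReducts {A : Type*} [CommRing A] [DecidableEq A[X]] (p : A[X]) (K : Finset A[X]) :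
    Finset A[X] :=
  insert p.eraseLead ((insert (derivative p) K).biUnion fun q =>
    (Finset.range (q.natDegree + 1)).image (p.truncRem q))

open Polynomial in
lemma natDegree_lt_of_mem_hormanderReducts {A : Type*} [CommRing A] [DecidableEq A[X]]
    {p : A[X]} {K : Finset A[X]} (hp : 0 < p.natDegree)
    (hK : ∀ q ∈ K, q.natDegree ≤ p.natDegree) {r : A[X]} (hr : r ∈ hormanderReducts p K) :
    r.natDegree < p.natDegree := by
  rw [hormanderReducts, Finset.mem_insert, Finset.mem_biUnion] at hr
  rcases hr with rfl | ⟨q, hq, hr⟩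
  · have := p.eraseLead_natDegree_le
    omega
  · obtain ⟨k, hk, rfl⟩ := Finset.mem_image.1 hr
    rw [Finset.mem_range] at hk
    have hq' : q.natDegree ≤ p.natDegree := by
      rcases Finset.mem_insert.1 hq with rfl | hq
      · exact (natDegree_derivative_le p).trans (Nat.sub_le _ _)
      · exact hK q hq
    have hdeg : (p.truncRem q k).degree < k := (p.exists_truncRem q k).choose_spec.1
    by_cases h0 : p.truncRem q k = 0
    · rwa [h0, natDegree_zero]
    · have := (natDegree_lt_iff_degree_lt h0).2 hdeg
      omega

open Polynomial in
lemma HasSignLift.mono {A : Type*} [CommRing A] {G H : Finset A[X]} (hH : HasSignLift H)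
    (hGH : G ⊆ H) : HasSignLift G := by
  obtain ⟨F, hF⟩ := hH
  refine ⟨F, fun σ τ h => ?_⟩
  obtain ⟨φ, hφ⟩ := hF σ τ h
  exact ⟨φ, fun p hp => hφ p (hGH hp)⟩

open Polynomial in
lemma hasSignLift_insert {A : Type*} [CommRing A] [DecidableEq A[X]] {p : A[X]}
    {K : Finset A[X]} (hp : 0 < p.natDegree)
    (h : HasSignLift (insert (derivative p) K ∪ hormanderReducts p K)) :
    HasSignLift (insert p K) := by
  classical
  obtain ⟨F, hF⟩ := h
  refine ⟨F ∪ (insert p (insert (derivative p) K)).biUnion Polynomial.coeffs, fun σ τ hστ => ?_⟩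
  obtain ⟨φ, hφ⟩ := hF σ τ fun a ha => hστ a (Finset.mem_union_left _ ha)
  have hco : ∀ q ∈ insert p (insert (derivative p) K), ∀ i,
      SignType.sign (σ (q.coeff i)) = SignType.sign (τ (q.coeff i)) := by
    intro q hq i
    by_cases h0 : q.coeff i = 0
    · simp [h0]
    · exact hστ _ (Finset.mem_union_right _ (Finset.mem_biUnion.2 ⟨q, hq, coeff_mem_coeffs h0⟩))
  have hlead := hco p (by simp) p.natDegree
  by_cases hσ : σ p.leadingCoeff = 0
  · have hτ : τ p.leadingCoeff = 0 := by
      rw [coeff_natDegree, hσ, sign_zero, eq_comm, sign_eq_zero_iff] at hlead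
      exact hlead
    have herase : ∀ ρ : A →+* ℝ, ρ p.leadingCoeff = 0 → p.map ρ = p.eraseLead.map ρ := by
      intro ρ hρ
      conv_lhs => rw [← p.eraseLead_add_C_mul_X_pow, Polynomial.map_add, Polynomial.map_mul, map_C,
        hρ, C_0, zero_mul, add_zero]
    refine ⟨φ, fun q hq => ?_⟩
    rcases Finset.mem_insert.1 hq with rfl | hq
    · rw [herase σ hσ, herase τ hτ]
      exact hφ _ (Finset.mem_union_right _ (by simp [hormanderReducts]))
    · exact hφ q (by simp [hq])
  have hτ : τ p.leadingCoeff ≠ 0 := by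
    intro h0
    rw [coeff_natDegree, h0, sign_zero, sign_eq_zero_iff] at hlead
    exact hσ hlead
  have hdσ := natDegree_map_of_leadingCoeff_ne_zero σ hσ
  have hdτ := natDegree_map_of_leadingCoeff_ne_zero τ hτ
  have hne : ∀ r : ℝ[X], 0 < r.natDegree → r ≠ 0 ∧ derivative r ≠ 0 := by
    refine fun r hr => ⟨?_, fun h0 => ?_⟩
    · rintro rfl; simp at hr
    · exact hr.ne' (derivative_eq_zero.1 h0)
  obtain ⟨hpσ, hpσ'⟩ := hne (p.map σ) (hdσ ▸ hp)
  obtain ⟨hpτ, hpτ'⟩ := hne (p.map τ) (hdτ ▸ hp)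
  set Z : Finset ℝ := (insert (derivative p) K).biUnion fun q => (q.map σ).roots.toFinset with hZ
  have hder : ∀ y, (derivative (p.map σ)).eval y = 0 → y ∈ Z := by
    intro y hy
    rw [hZ, Finset.mem_biUnion]
    refine ⟨_, Finset.mem_insert_self _ _, ?_⟩
    rw [derivative_map] at hy hpσ'
    rw [Multiset.mem_toFinset, mem_roots hpσ']
    exact hy
  obtain ⟨ψ, hψZ, hψ⟩ := exists_orderIso_sign_eval (p := p.map σ) (q := p.map τ) hpσ hpτ
    (hdσ.trans hdτ.symm)
    (by rwa [leadingCoeff, leadingCoeff, hdσ, hdτ, coeff_map, coeff_map]) φ Z hder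
    (fun y hy => by
      refine hder _ ?_
      have := hφ (derivative p) (by simp) (φ.symm y)
      rw [φ.apply_symm_apply, ← derivative_map, ← derivative_map, hy, sign_zero] at this
      exact sign_eq_zero_iff.1 this)
    (fun z hz => by
      obtain ⟨q, hq, hqz⟩ := Finset.mem_biUnion.1 hz
      rw [Multiset.mem_toFinset, mem_roots'] at hqz
      refine sign_eval_eq_of_truncRem (hco q (Finset.mem_insert_of_mem hq)) hqz.1 hqz.2 ?_ ?_
      · have := hφ q (Finset.mem_union_left _ hq) z
        rw [hqz.2.eq_zero, sign_zero, eq_comm, sign_eq_zero_iff] at this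
        exact this
      · intro k hk
        refine hφ _ (Finset.mem_union_right _ (Finset.mem_insert_of_mem
          (Finset.mem_biUnion.2 ⟨q, hq, Finset.mem_image_of_mem _ ?_⟩))) z
        rw [Finset.mem_range]
        omega)
  refine ⟨ψ, fun q hq => ?_⟩
  rcases Finset.mem_insert.1 hq with rfl | hq
  · exact hψ
  · refine sign_eval_eq_of_orderIso_eqOn_roots (hφ q (by simp [hq])) fun z hz => hψZ z ?_
    exact Finset.mem_biUnion.2 ⟨q, by simp [hq], by simpa using hz⟩

open Polynomial in
theorem hasSignLift {A : Type*} [CommRing A] (G : Finset A[X]) : HasSignLift G := by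
  classical
  suffices ∀ (d : ℕ) (G : Finset A[X]), (∀ p ∈ G, p.natDegree ≤ d) → HasSignLift G from
    this (G.sup natDegree) G fun p hp => Finset.le_sup (f := natDegree) hp
  intro d
  induction d with
  | zero =>
    intro G hG
    refine ⟨G.image fun p => p.coeff 0, fun σ τ h => ⟨OrderIso.refl ℝ, fun p hp y => ?_⟩⟩
    rw [eq_C_of_natDegree_le_zero (hG p hp)]
    simpa using h _ (Finset.mem_image_of_mem _ hp)
  | succ d ih =>
    have key : ∀ T L : Finset A[X], (∀ q ∈ L, q.natDegree ≤ d) →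
        (∀ q ∈ T, q.natDegree ≤ d + 1) → HasSignLift (T ∪ L) := by
      intro T
      induction T using Finset.induction_on with
      | empty => exact fun L hL _ => by simpa using ih L hL
      | insert p T _ ihT =>
        intro L hL hT
        have hp := hT p (Finset.mem_insert_self p T)
        have hT' : ∀ q ∈ T, q.natDegree ≤ d + 1 := fun q hq => hT q (Finset.mem_insert_of_mem hq)
        rcases hp.lt_or_eq with hp | hp
        · refine (ihT (insert p L) ?_ hT').mono (by
            intro q; simp only [Finset.mem_union, Finset.mem_insert]; tauto)
          intro q hq
          rcases Finset.mem_insert.1 hq with rfl | hq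
          · omega
          · exact hL q hq
        · rw [Finset.insert_union]
          refine hasSignLift_insert (by omega) ((ihT (insert (derivative p) L ∪
            hormanderReducts p (T ∪ L)) ?_ hT').mono (by
            intro q; simp only [Finset.mem_union, Finset.mem_insert]; tauto))
          intro q hq
          rcases Finset.mem_union.1 hq with hq | hq
          · rcases Finset.mem_insert.1 hq with rfl | hq
            · have := natDegree_derivative_le p
              omega
            · exact hL q hq
          · have := natDegree_lt_of_mem_hormanderReducts (by omega) (fun q hq => ?_) hq
            · omega
            · rcases Finset.mem_union.1 hq with hq | hq
              · exact hp ▸ hT' q hq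
              · have := hL q hq
                omega
    intro G hG
    simpa using key G ∅ (by simp) hG

theorem MvPolynomial.exists_finset_sign_lift {A : Type*} [CommRing A] (n : ℕ)
    (G : Finset (MvPolynomial (Fin n) A)) :
    ∃ F : Finset A, ∀ σ τ : A →+* ℝ, (∀ a ∈ F, SignType.sign (σ a) = SignType.sign (τ a)) →
      ∀ x : Fin n → ℝ, ∃ y : Fin n → ℝ, ∀ p ∈ G,
        SignType.sign (p.eval₂ σ x) = SignType.sign (p.eval₂ τ y) := by
  classical
  induction n with
  | zero =>
    refine ⟨G.image fun p => p.coeff 0, fun σ τ h x => ⟨x, fun p hp => ?_⟩⟩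
    rw [MvPolynomial.eq_C_of_isEmpty p, eval₂_C, eval₂_C]
    exact h _ (Finset.mem_image_of_mem _ hp)
  | succ n ih =>
    have hcons : ∀ (ρ : A →+* ℝ) (s : Fin n → ℝ) (y : ℝ) (p : MvPolynomial (Fin (n + 1)) A),
        p.eval₂ ρ (Fin.cons y s) =
          ((finSuccEquiv A n p).map (eval₂Hom ρ s)).eval y := by
      intro ρ s y p
      induction p using MvPolynomial.induction_on with
      | C a => simp [finSuccEquiv_apply]
      | add p q hp hq => simp only [eval₂_add, hp, hq, map_add, Polynomial.map_add,
          Polynomial.eval_add]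
      | mul_X p i hp =>
        rw [eval₂_mul, hp, map_mul, Polynomial.map_mul, Polynomial.eval_mul, eval₂_X]
        congr 1
        refine Fin.cases ?_ (fun j => ?_) i
        · simp [finSuccEquiv_X_zero]
        · simp [finSuccEquiv_X_succ]
    obtain ⟨F₁, hF₁⟩ := hasSignLift (G.image (finSuccEquiv A n))
    obtain ⟨F, hF⟩ := ih F₁
    refine ⟨F, fun σ τ h x => ?_⟩
    obtain ⟨s, hs⟩ := hF σ τ h (Fin.tail x)
    obtain ⟨φ, hφ⟩ := hF₁ (eval₂Hom σ (Fin.tail x)) (eval₂Hom τ s) hs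
    refine ⟨Fin.cons (φ (x 0)) s, fun p hp => ?_⟩
    rw [← Fin.cons_self_tail x, hcons, hcons]
    exact hφ _ (Finset.mem_image_of_mem _ hp) (x 0)

open Polynomial in
lemma Polynomial.exists_forall_sign_eval_eq (F : Finset ℝ[X]) :
    ∃ R : ℝ, ∀ s t : ℝ, R ≤ s → R ≤ t →
      ∀ a ∈ F, SignType.sign (a.eval s) = SignType.sign (a.eval t) := by
  have h : ∀ᶠ y : ℝ in atTop, ∀ a ∈ F, SignType.sign (a.eval y) = SignType.sign a.leadingCoeff :=
    (Finset.eventually_all F).2 fun a _ => a.eventually_sign_eval_eq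
  obtain ⟨R, hR⟩ := eventually_atTop.1 h
  exact ⟨R, fun s t hs ht a ha => (hR s hs a ha).trans (hR t ht a ha).symm⟩

lemma IsPolyFun.continuous {n : ℕ} {f : EuclideanSpace ℝ (Fin n) → ℝ} (hf : IsPolyFun f) :
    Continuous f := by
  obtain ⟨P, hP⟩ := hf
  rw [funext hP]
  exact P.continuous_eval.comp (by fun_prop)

lemma isClosed_conSet {n l m : ℕ} {g : Fin l → EuclideanSpace ℝ (Fin n) → ℝ}
    {h : Fin m → EuclideanSpace ℝ (Fin n) → ℝ} (hg : ∀ i, Continuous (g i))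
    (hh : ∀ j, Continuous (h j)) : IsClosed (conSet g h) := by
  have : conSet g h = (⋂ i, {x | g i x = 0}) ∩ ⋂ j, {x | 0 ≤ h j x} := by
    ext x; simp [conSet]
  rw [this]
  exact (isClosed_iInter fun i => isClosed_eq (hg i) continuous_const).inter
    (isClosed_iInter fun j => isClosed_le continuous_const (hh j))

theorem sphere_slices_eventually_nonempty_compact {n l m : ℕ}
    (g : Fin l → EuclideanSpace ℝ (Fin n) → ℝ) (h : Fin m → EuclideanSpace ℝ (Fin n) → ℝ)
    (hg : ∀ i, IsPolyFun (g i)) (hh : ∀ j, IsPolyFun (h j))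
    (hS : (conSet g h).Nonempty) (hSu : ¬ Bornology.IsBounded (conSet g h)) :
    ∃ R : ℝ, 0 < R ∧ ∀ t : ℝ, R ≤ t →
      ({x | x ∈ conSet g h ∧ ‖x‖ = t} : Set (EuclideanSpace ℝ (Fin n))).Nonempty ∧
      IsCompact ({x | x ∈ conSet g h ∧ ‖x‖ = t} : Set (EuclideanSpace ℝ (Fin n))) := by
  classical
  have hclosed := isClosed_conSet (fun i => (hg i).continuous) (fun j => (hh j).continuous)
  choose P hP using hg
  choose Q hQ using hh
  let lift : MvPolynomial (Fin n) ℝ → MvPolynomial (Fin n) (Polynomial ℝ) :=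
    MvPolynomial.map Polynomial.C
  let N : MvPolynomial (Fin n) (Polynomial ℝ) :=
    (∑ i, MvPolynomial.X i ^ 2) - MvPolynomial.C (Polynomial.X ^ 2)
  have hlift : ∀ (t : ℝ) (x : Fin n → ℝ) (p : MvPolynomial (Fin n) ℝ),
      (lift p).eval₂ (Polynomial.evalRingHom t) x = MvPolynomial.eval x p := by
    intro t x p
    have : (Polynomial.evalRingHom t).comp Polynomial.C = RingHom.id ℝ := by ext; simp
    rw [MvPolynomial.eval₂_map, this, MvPolynomial.eval₂_id]
  have hN : ∀ (t : ℝ) (x : EuclideanSpace ℝ (Fin n)),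
      N.eval₂ (Polynomial.evalRingHom t) (fun i => x i) = ‖x‖ ^ 2 - t ^ 2 := by
    intro t x
    simp only [N, EuclideanSpace.norm_sq_eq, Real.norm_eq_abs, sq_abs]
    rw [← MvPolynomial.coe_eval₂Hom]
    simp
  obtain ⟨F, hF⟩ := MvPolynomial.exists_finset_sign_lift n
    (insert N (Finset.univ.image (fun i => lift (P i)) ∪ Finset.univ.image fun j => lift (Q j)))
  obtain ⟨R, hR⟩ := Polynomial.exists_forall_sign_eval_eq F
  refine ⟨max R 1, by positivity, fun t ht => ⟨?_, ?_⟩⟩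
  · obtain ⟨x, hx, hxR⟩ : ∃ x ∈ conSet g h, max R 1 ≤ ‖x‖ := by
      by_contra! hcon
      exact hSu (isBounded_iff_forall_norm_le.2 ⟨max R 1, fun x hx => (hcon x hx).le⟩)
    obtain ⟨y, hy⟩ := hF (Polynomial.evalRingHom ‖x‖) (Polynomial.evalRingHom t)
      (hR _ _ ((le_max_left _ _).trans hxR) ((le_max_left _ _).trans ht)) fun i => x i
    refine ⟨WithLp.toLp 2 y, ⟨fun i => ?_, fun j => ?_⟩, ?_⟩
    · have := hy (lift (P i)) (by simp)
      rw [hlift, hlift, ← hP, hx.1 i, sign_zero, eq_comm, sign_eq_zero_iff] at this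
      rw [hP]
      exact this
    · have := hy (lift (Q j)) (by simp)
      rw [hlift, hlift, ← hQ] at this
      rw [hQ]
      have h0 := sign_nonneg_iff.2 (hx.2 j)
      rw [this] at h0
      exact sign_nonneg_iff.1 h0
    · have h1 := hy N (by simp)
      have h2 := hN t (WithLp.toLp 2 y)
      rw [hN, sub_self, sign_zero, eq_comm, sign_eq_zero_iff] at h1
      have ht0 : 0 ≤ t := zero_le_one.trans ((le_max_right _ _).trans ht)
      rw [← sq_eq_sq₀ (norm_nonneg _) ht0, ← sub_eq_zero, ← h2]
      exact h1
  · refine Metric.isCompact_of_isClosed_isBounded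
      (hclosed.inter (isClosed_eq continuous_norm continuous_const))
      (isBounded_iff_forall_norm_le.2 ⟨t, fun x hx => hx.2.le⟩)
end
end

section
/- Assume LICQ holds on S and that f is coercive on S. Then there exist real numbers ε > 0 and α > 0 such that for every continuous function g : S → ℝ for which there exists R' > 0 with |g(x)| ≤ ε‖x‖^α for all x ∈ S with ‖x‖ ≥ R', the function f + g is coercive on S. -/
open Filter

noncomputable section

theorem Derivation.exists_extension_of_formallyEtale {R S T M : Type*} [CommRing R] [CommRing S]
    [CommRing T] [Algebra R S] [Algebra R T] [Algebra S T] [IsScalarTower R S T]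
    [Algebra.FormallyEtale S T] [AddCommGroup M] [Module R M] [Module S M] [Module T M]
    [IsScalarTower S T M] [IsScalarTower R S M] [IsScalarTower R T M]
    (d : Derivation R S M) :
    ∃ D : Derivation R T M, ∀ s, D (algebraMap S T s) = d s := by
  refine ⟨(((KaehlerDifferential.isBaseChange_of_formallyEtale R S T).lift
    d.liftKaehlerDifferential)).compDer (KaehlerDifferential.D R T), fun s => ?_⟩
  have h := (KaehlerDifferential.isBaseChange_of_formallyEtale R S T).lift_eq
    d.liftKaehlerDifferential (KaehlerDifferential.D R S s)
  rw [KaehlerDifferential.map_D, Derivation.liftKaehlerDifferential_comp_D] at h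
  exact h

theorem IsTranscendenceBasis.exists_derivation {k K ι : Type*} [Field k] [CharZero k] [Field K]
    [Algebra k K] {x : ι → K} (hx : IsTranscendenceBasis k x) (a : ι → K) :
    ∃ D : Derivation k K K, ∀ i, D (x i) = a i := by
  let : Algebra (MvPolynomial ι k) K := (MvPolynomial.aeval x).toAlgebra
  have hmap : ∀ p : MvPolynomial ι k, algebraMap (MvPolynomial ι k) K p = MvPolynomial.aeval x p :=
    fun _ => rfl
  have : IsScalarTower k (MvPolynomial ι k) K := .of_algebraMap_eq fun r => by
    rw [hmap]; simp
  have : FaithfulSMul (MvPolynomial ι k) K :=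
    (faithfulSMul_iff_algebraMap_injective _ _).2 hx.1
  let := FractionRing.liftAlgebra (MvPolynomial ι k) K
  have : Algebra.IsAlgebraic (MvPolynomial ι k) K := by
    have := hx.isAlgebraic
    refine ⟨fun y => ?_⟩
    have hy := Algebra.IsAlgebraic.isAlgebraic (R := Algebra.adjoin k (Set.range x)) y
    refine (isAlgebraic_ringHom_iff_of_comp_eq hx.1.aevalEquiv (RingHom.id K)
      Function.injective_id ?_).1 hy
    ext p <;> simp [hmap]
  have : Algebra.IsAlgebraic (FractionRing (MvPolynomial ι k)) K :=
    (IsFractionRing.comap_isAlgebraic_iff (A := MvPolynomial ι k)).1 inferInstance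
  have : CharZero (FractionRing (MvPolynomial ι k)) :=
    charZero_of_injective_algebraMap (algebraMap k (FractionRing (MvPolynomial ι k))).injective
  have : Algebra.FormallyEtale (FractionRing (MvPolynomial ι k)) K :=
    .of_isSeparable _ _
  have : Algebra.FormallyEtale (MvPolynomial ι k) (FractionRing (MvPolynomial ι k)) :=
    .of_isLocalization (nonZeroDivisors _)
  have : Algebra.FormallyEtale (MvPolynomial ι k) K :=
    .comp _ (FractionRing (MvPolynomial ι k)) _
  obtain ⟨D, hD⟩ := (MvPolynomial.mkDerivation k a).exists_extension_of_formallyEtale (T := K)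
  refine ⟨D, fun i => ?_⟩
  simpa [hmap] using hD (MvPolynomial.X i)

theorem AlgebraicIndependent.exists_derivation {k K ι : Type*} [Field k] [CharZero k] [Field K]
    [Algebra k K] {x : ι → K} (hx : AlgebraicIndependent k x) (a : ι → K) :
    ∃ D : Derivation k K K, ∀ i, D (x i) = a i := by
  obtain ⟨t, hxt, ht⟩ := exists_isTranscendenceBasis_superset hx.coe_range
  obtain ⟨D, hD⟩ := ht.exists_derivation
    (fun y : t => Function.extend x a 0 (y : K))
  refine ⟨D, fun i => ?_⟩
  have h := hD ⟨x i, hxt ⟨i, rfl⟩⟩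
  simpa [hx.injective.extend_apply] using h

theorem Derivation.map_mvPolynomial_aeval {k A M σ : Type*} [CommRing k] [CommRing A] [Algebra k A]
    [AddCommGroup M] [Module k M] [Module A M] [IsScalarTower k A M] [Fintype σ]
    (D : Derivation k A M) (x : σ → A) (p : MvPolynomial σ k) :
    D (MvPolynomial.aeval x p) =
      ∑ i, MvPolynomial.aeval x (MvPolynomial.pderiv i p) • D (x i) := by
  classical
  induction p using MvPolynomial.induction_on with
  | C r => simp
  | add p q hp hq => simp [hp, hq, add_smul, Finset.sum_add_distrib]
  | mul_X p j hp =>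
    simp [hp, add_smul, Finset.sum_add_distrib, MvPolynomial.pderiv_X, Pi.single_apply,
      Finset.smul_sum, mul_smul, apply_ite, ite_smul]

theorem AlgebraicIndependent.exists_algHom_field.{u} {k ι : Type*} {A : Type u} [Field k] [CommRing A]
    [Algebra k A] {w : ι → A} (hw : AlgebraicIndependent k w) :
    ∃ (K : Type u) (_ : Field K) (_ : Algebra k K) (φ : A →ₐ[k] K),
      AlgebraicIndependent k (φ ∘ w) := by
  obtain ⟨P, hP, hPw⟩ := Ideal.exists_comap_eq_of_mem_minimalPrimes_of_injective
    (f := (MvPolynomial.aeval w : MvPolynomial ι k →ₐ[k] A).toRingHom) hw ⊥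
    (by rw [IsDomain.minimalPrimes_eq_singleton_bot]; rfl)
  refine ⟨FractionRing (A ⧸ P), inferInstance, inferInstance,
    IsScalarTower.toAlgHom k A (FractionRing (A ⧸ P)), algebraicIndependent_iff.2 fun p hp => ?_⟩
  have hpP : MvPolynomial.aeval w p ∈ P := by
    rw [Function.comp_def, ← MvPolynomial.comp_aeval_apply, IsScalarTower.coe_toAlgHom',
      IsScalarTower.algebraMap_apply A (A ⧸ P), FaithfulSMul.algebraMap_eq_zero_iff] at hp
    exact Ideal.Quotient.eq_zero_iff_mem.1 hp
  have hp' : p ∈ Ideal.comap (MvPolynomial.aeval w : MvPolynomial ι k →ₐ[k] A).toRingHom P := hpP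
  rwa [hPw] at hp'

theorem MvPolynomial.not_algebraicIndependent_of_multipliers {k K σ ι : Type*} [Field k]
    [CharZero k] [Field K] [Algebra k K] [Fintype σ] [Fintype ι] {F U : MvPolynomial σ k}
    {G : ι → MvPolynomial σ k} {x : σ → K} {c : K} {μ : ι → K} (hG : ∀ i, aeval x (G i) = 0)
    (hF : ∀ j, aeval x (pderiv j F) =
      c * aeval x (pderiv j U) + ∑ i, μ i * aeval x (pderiv j (G i))) :
    ¬ AlgebraicIndependent k ![aeval x U, aeval x F] := by
  intro hind
  obtain ⟨D, hD⟩ := hind.exists_derivation ![0, 1]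
  have hDU : D (aeval x U) = 0 := hD 0
  have hDF : D (aeval x F) = 1 := hD 1
  have hkey : D (aeval x F) = c * D (aeval x U) + ∑ i, μ i * D (aeval x (G i)) := by
    simp only [D.map_mvPolynomial_aeval, smul_eq_mul, hF, add_mul, Finset.sum_add_distrib,
      Finset.mul_sum, Finset.sum_mul, mul_assoc]
    rw [Finset.sum_comm]
  simp [hDF, hDU, hG] at hkey

/-- On the set of points satisfying a Lagrange multiplier rule for `F` relative to `U` and `G`,
the polynomials `U` and `F` are algebraically dependent. -/
theorem MvPolynomial.exists_relation_of_multipliers {k σ ι : Type*} [Field k] [CharZero k]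
    [Fintype σ] [Fintype ι] (F U : MvPolynomial σ k) (G : ι → MvPolynomial σ k) :
    ∃ p : MvPolynomial (Fin 2) k, p ≠ 0 ∧ ∀ (x : σ → k) (c : k) (μ : ι → k),
      (∀ i, eval x (G i) = 0) →
      (∀ j, eval x (pderiv j F) = c * eval x (pderiv j U) + ∑ i, μ i * eval x (pderiv j (G i))) →
      eval ![eval x U, eval x F] p = 0 := by
  by_contra! hcon
  let τ := σ ⊕ Option ι
  let e : MvPolynomial σ k →ₐ[k] MvPolynomial τ k := rename Sum.inl
  let L : σ → MvPolynomial τ k := fun j => e (pderiv j F) - (X (Sum.inr none) * e (pderiv j U) +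
    ∑ i, X (Sum.inr (some i)) * e (pderiv j (G i)))
  let Z : Set (τ → k) := {z | (∀ i, eval z (e (G i)) = 0) ∧ ∀ j, eval z (L j) = 0}
  let I : Ideal (MvPolynomial τ k) := vanishingIdeal k Z
  let q : MvPolynomial τ k →ₐ[k] MvPolynomial τ k ⧸ I := Ideal.Quotient.mkₐ k I
  have hq : ∀ r, q r = 0 ↔ ∀ z ∈ Z, eval z r = 0 := fun r => Ideal.Quotient.eq_zero_iff_mem
  have hw : AlgebraicIndependent k ![q (e U), q (e F)] := by
    rw [algebraicIndependent_iff]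
    intro p hp
    by_contra hp0
    obtain ⟨x, c, μ, hG, hL, hx⟩ := hcon p hp0
    apply hx
    let z : τ → k := Sum.elim x (fun o => o.elim c μ)
    have hz : ∀ r, eval z (e r) = eval x r := fun r => by
      simp only [e, eval_rename]; rfl
    have hzZ : z ∈ Z := by
      refine ⟨fun i => by rw [hz]; exact hG i, fun j => ?_⟩
      simp only [L, map_sub, map_add, map_mul, map_sum, hz, eval_X, hL j]
      simp [z]
    have hcomp : q.comp (aeval ![e U, e F]) =
        (aeval ![q (e U), q (e F)] : MvPolynomial (Fin 2) k →ₐ[k] _) := by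
      ext i; fin_cases i <;> simp
    have h0 : aeval z (aeval ![e U, e F] p) = 0 := by
      refine (hq _).1 ?_ z hzZ
      rw [← hp, ← hcomp, AlgHom.comp_apply]
    have hcomp' : (aeval z : MvPolynomial τ k →ₐ[k] k).comp (aeval ![e U, e F])
        = (aeval ![eval x U, eval x F] : MvPolynomial (Fin 2) k →ₐ[k] k) := by
      ext i; fin_cases i <;> simp [aeval_eq_eval, hz]
    rw [← AlgHom.comp_apply, hcomp'] at h0
    exact h0
  obtain ⟨K, _, _, ψ, hind⟩ := hw.exists_algHom_field
  let φ := ψ.comp q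
  have hφ : ∀ r, (∀ z ∈ Z, eval z r = 0) → φ r = 0 := fun r hr => by
    simp only [φ, AlgHom.comp_apply, (hq r).2 hr, map_zero]
  have hx : ∀ r, aeval (fun j => φ (X (Sum.inl j))) r = φ (e r) := fun r => by
    rw [← AlgHom.comp_apply]
    congr 1
    ext i; simp [e]
  refine not_algebraicIndependent_of_multipliers (F := F) (U := U) (G := G)
    (x := fun j => φ (X (Sum.inl j))) (c := φ (X (Sum.inr none)))
    (μ := fun i => φ (X (Sum.inr (some i)))) (fun i => ?_) (fun j => ?_) ?_
  · rw [hx]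
    exact hφ _ fun z hz => hz.1 i
  · simp only [hx]
    have h := hφ (L j) fun z hz => hz.2 j
    rw [map_sub, sub_eq_zero] at h
    simpa only [map_add, map_mul, map_sum] using h
  · rw [hx, hx]
    convert hind using 1
    ext i; fin_cases i <;> rfl

theorem MvPolynomial.exists_pow_lt_of_eval_eq_zero {p : MvPolynomial (Fin 2) ℝ} (hp : p ≠ 0) :
    ∃ (N : ℕ) (T : ℝ), 0 < N ∧ 1 ≤ T ∧
      ∀ s t : ℝ, T ≤ t → eval ![s, t] p = 0 → s < t ^ N := by
  classical
  obtain ⟨d, hd, hmax⟩ := p.support.exists_max_image (fun e => toLex (e 0, e 1))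
    (support_nonempty.2 hp)
  have hcd : 0 < |coeff d p| := abs_pos.2 (mem_support_iff.1 hd)
  set B := ∑ e ∈ p.support, |coeff e p| with hB
  refine ⟨p.totalDegree + 1, B / |coeff d p| + 1, by omega, ?_, fun s t ht h0 => ?_⟩
  · have : 0 ≤ B := Finset.sum_nonneg fun _ _ => abs_nonneg _
    have := div_nonneg this hcd.le
    linarith
  by_contra! hs
  have hB0 : 0 ≤ B / |coeff d p| :=
    div_nonneg (Finset.sum_nonneg fun _ _ => abs_nonneg _) hcd.le
  have ht1 : 1 ≤ t := by linarith
  have hs1 : 1 ≤ s := (one_le_pow₀ ht1).trans hs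
  have hM : 0 < s ^ d 0 * t ^ d 1 := by positivity
  have hdom : ∀ e ∈ p.support, e ≠ d → s ^ e 0 * t ^ e 1 * t ≤ s ^ d 0 * t ^ d 1 := by
    intro e he hne
    have h := hmax e he
    rw [Prod.Lex.toLex_le_toLex] at h
    rcases h with h | ⟨h, h'⟩
    · have hle : e 1 ≤ p.totalDegree := by
        refine le_trans ?_ (le_totalDegree he)
        rw [Finsupp.sum_fintype _ _ (fun _ => rfl), Fin.sum_univ_two]
        omega
      calc s ^ e 0 * t ^ e 1 * t = s ^ e 0 * t ^ (e 1 + 1) := by ring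
        _ ≤ s ^ e 0 * t ^ (p.totalDegree + 1) := by gcongr
        _ ≤ s ^ e 0 * s := by gcongr
        _ = s ^ (e 0 + 1) := by ring
        _ ≤ s ^ d 0 := pow_le_pow_right₀ hs1 h
        _ ≤ s ^ d 0 * t ^ d 1 := le_mul_of_one_le_right (by positivity) (one_le_pow₀ ht1)
    · simp only at h h'
      have h1 : e 1 ≠ d 1 := fun h1 => hne <| by
        ext i; fin_cases i <;> assumption
      calc s ^ e 0 * t ^ e 1 * t = s ^ d 0 * t ^ (e 1 + 1) := by rw [h]; ring
        _ ≤ s ^ d 0 * t ^ d 1 := by gcongr; omega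
  rw [eval_eq'] at h0
  simp only [Fin.prod_univ_two, Matrix.cons_val_zero, Matrix.cons_val_one] at h0
  rw [← Finset.add_sum_erase _ _ hd] at h0
  have hrest : |∑ e ∈ p.support.erase d, coeff e p * (s ^ e 0 * t ^ e 1)| * t
      ≤ B * (s ^ d 0 * t ^ d 1) := by
    calc _ ≤ (∑ e ∈ p.support.erase d, |coeff e p * (s ^ e 0 * t ^ e 1)|) * t := by
          gcongr; exact Finset.abs_sum_le_sum_abs _ _
      _ = ∑ e ∈ p.support.erase d, |coeff e p| * (s ^ e 0 * t ^ e 1 * t) := by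
          rw [Finset.sum_mul]
          refine Finset.sum_congr rfl fun e _ => ?_
          rw [abs_mul, abs_of_nonneg (by positivity : 0 ≤ s ^ e 0 * t ^ e 1)]; ring
      _ ≤ ∑ e ∈ p.support.erase d, |coeff e p| * (s ^ d 0 * t ^ d 1) := by
          refine Finset.sum_le_sum fun e he => ?_
          have := hdom e (Finset.mem_of_mem_erase he) (Finset.ne_of_mem_erase he)
          gcongr
      _ ≤ B * (s ^ d 0 * t ^ d 1) := by
          rw [← Finset.sum_mul]
          gcongr
          exact Finset.sum_le_sum_of_subset_of_nonneg (Finset.erase_subset _ _)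
            fun _ _ _ => abs_nonneg _
  rw [← neg_eq_of_add_eq_zero_right h0, abs_neg, abs_mul, abs_of_pos hM] at hrest
  have h1 : |coeff d p| * t ≤ B := by
    refine le_of_mul_le_mul_right ?_ hM
    linarith
  have h2 : B / |coeff d p| < t := by linarith
  rw [div_lt_iff₀ hcd] at h2
  linarith

/-- The gradient of a polynomial function, as a vector of Euclidean space. -/
def MvPolynomial.grad {n : ℕ} (P : MvPolynomial (Fin n) ℝ) (x : EuclideanSpace ℝ (Fin n)) :
    EuclideanSpace ℝ (Fin n) :=
  WithLp.toLp 2 fun j => MvPolynomial.eval (fun i => x i) (MvPolynomial.pderiv j P)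

theorem MvPolynomial.hasStrictFDerivAt_eval {n : ℕ} (P : MvPolynomial (Fin n) ℝ)
    (x : EuclideanSpace ℝ (Fin n)) :
    HasStrictFDerivAt (fun y : EuclideanSpace ℝ (Fin n) => eval (fun i => y i) P)
      (innerSL ℝ (P.grad x)) x := by
  induction P using MvPolynomial.induction_on with
  | C r =>
    simp only [eval_C]
    refine (hasStrictFDerivAt_const r x).congr_fderiv ?_
    ext v
    simp [grad, PiLp.inner_apply]
  | add p q hp hq =>
    simp only [map_add]
    refine (hp.add hq).congr_fderiv ?_
    ext v
    simp [grad, PiLp.inner_apply, mul_add, Finset.sum_add_distrib]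
  | mul_X p j hp =>
    simp only [map_mul, eval_X]
    refine (hp.mul (EuclideanSpace.proj j : EuclideanSpace ℝ (Fin n) →L[ℝ] ℝ).hasStrictFDerivAt
      ).congr_fderiv ?_
    ext v
    simp [grad, PiLp.inner_apply, pderiv_X, mul_add, Finset.sum_add_distrib, Pi.single_apply,
      Finset.mul_sum, apply_ite]
    simp only [mul_comm, mul_left_comm]

theorem MvPolynomial.continuous_eval_euclidean {n : ℕ} (P : MvPolynomial (Fin n) ℝ) :
    Continuous fun y : EuclideanSpace ℝ (Fin n) => eval (fun i => y i) P :=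
  continuous_iff_continuousAt.2 fun x => (P.hasStrictFDerivAt_eval x).hasFDerivAt.continuousAt

theorem MvPolynomial.gradient_eval {n : ℕ} (P : MvPolynomial (Fin n) ℝ)
    (x : EuclideanSpace ℝ (Fin n)) :
    gradient (fun y : EuclideanSpace ℝ (Fin n) => eval (fun i => y i) P) x = P.grad x := by
  refine HasGradientAt.gradient ?_
  rw [hasGradientAt_iff_hasFDerivAt]
  exact (P.hasStrictFDerivAt_eval x).hasFDerivAt

/-- The polynomial `∑ X_i ^ 2`. -/
def MvPolynomial.normSq (n : ℕ) : MvPolynomial (Fin n) ℝ := ∑ i, MvPolynomial.X i ^ 2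

theorem MvPolynomial.eval_normSq {n : ℕ} (x : EuclideanSpace ℝ (Fin n)) :
    eval (fun i => x i) (normSq n) = ‖x‖ ^ 2 := by
  simp [normSq, EuclideanSpace.norm_sq_eq]

open MvPolynomial in
theorem IsLocalExtrOn.exists_multipliers_of_linearIndependent {n : ℕ} {ι : Type*} [Fintype ι]
    {F U : MvPolynomial (Fin n) ℝ} {G : ι → MvPolynomial (Fin n) ℝ} {x : EuclideanSpace ℝ (Fin n)}
    (hli : LinearIndependent ℝ fun i => (G i).grad x)
    (hmin : IsLocalExtrOn (fun y : EuclideanSpace ℝ (Fin n) => eval (fun i => y i) F)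
      {y | (∀ i, eval (fun k => y k) (G i) = eval (fun k => x k) (G i)) ∧
        eval (fun k => y k) U = eval (fun k => x k) U} x) :
    (∃ (c : ℝ) (μ : ι → ℝ), F.grad x = c • U.grad x + ∑ i, μ i • (G i).grad x) ∨
    (∃ (c : ℝ) (μ : ι → ℝ), U.grad x = c • F.grad x + ∑ i, μ i • (G i).grad x) := by
  have hset : {y : EuclideanSpace ℝ (Fin n) |
        (∀ i, eval (fun k => y k) (G i) = eval (fun k => x k) (G i)) ∧
        eval (fun k => y k) U = eval (fun k => x k) U} =
      {y | ∀ o : Option ι, eval (fun k => y k) (o.elim U G) = eval (fun k => x k) (o.elim U G)} := by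
    ext y
    simp [Option.forall, and_comm]
  rw [hset] at hmin
  obtain ⟨Λ, Λ₀, hne, hsum⟩ := hmin.exists_multipliers_of_hasStrictFDerivAt
    (f := fun (o : Option ι) (y : EuclideanSpace ℝ (Fin n)) => eval (fun k => y k) (o.elim U G))
    (f' := fun o => innerSL ℝ ((o.elim U G).grad x)) (φ' := innerSL ℝ (F.grad x))
    (fun o => (o.elim U G).hasStrictFDerivAt_eval x) (F.hasStrictFDerivAt_eval x)
  have hvec : Λ₀ • F.grad x + Λ none • U.grad x + ∑ i, Λ (some i) • (G i).grad x = 0 := by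
    refine ext_inner_right ℝ fun v => ?_
    have := congrArg (fun T => T v) hsum
    simp only [Fintype.sum_option] at this
    simp only [inner_add_left, sum_inner, real_inner_smul_left, inner_zero_left]
    simp at this
    linarith
  by_cases h0 : Λ₀ = 0
  · by_cases h1 : Λ none = 0
    · refine absurd ?_ hne
      simp only [h0, h1, zero_smul, zero_add] at hvec
      have h2 := Fintype.linearIndependent_iff.1 hli _ hvec
      ext o
      · cases o with
        | none => exact h1
        | some i => exact h2 i
      · exact h0
    · right
      refine ⟨-(Λ none)⁻¹ * Λ₀, fun i => -(Λ none)⁻¹ * Λ (some i), ?_⟩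
      have h := congrArg (fun v => (Λ none)⁻¹ • v) hvec
      simp only [smul_add, Finset.smul_sum, smul_smul, inv_mul_cancel₀ h1, one_smul, smul_zero] at h
      simp only [neg_mul, neg_smul, Finset.sum_neg_distrib]
      rw [← sub_eq_zero, ← h]
      abel
  · left
    refine ⟨-Λ₀⁻¹ * Λ none, fun i => -Λ₀⁻¹ * Λ (some i), ?_⟩
    have h := congrArg (fun v => Λ₀⁻¹ • v) hvec
    simp only [smul_add, Finset.smul_sum, smul_smul, inv_mul_cancel₀ h0, one_smul, smul_zero] at h
    simp only [neg_mul, neg_smul, Finset.sum_neg_distrib]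
    rw [← sub_eq_zero, ← h]
    abel

/-- A polynomial relation, valid at every point where the Lagrange multiplier rule for extrema of
`F` on `{G = 0, U = const}` holds with non-degenerate `G`. -/
theorem MvPolynomial.exists_relation_of_isLocalExtrOn {n : ℕ} {ι : Type*} [Fintype ι]
    (F U : MvPolynomial (Fin n) ℝ) (G : ι → MvPolynomial (Fin n) ℝ) :
    ∃ p : MvPolynomial (Fin 2) ℝ, p ≠ 0 ∧ ∀ x : EuclideanSpace ℝ (Fin n),
      (∀ i, eval (fun k => x k) (G i) = 0) → (LinearIndependent ℝ fun i => (G i).grad x) →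
      IsLocalExtrOn (fun y : EuclideanSpace ℝ (Fin n) => eval (fun i => y i) F)
        {y | (∀ i, eval (fun k => y k) (G i) = eval (fun k => x k) (G i)) ∧
          eval (fun k => y k) U = eval (fun k => x k) U} x →
      eval ![eval (fun k => x k) U, eval (fun k => x k) F] p = 0 := by
  obtain ⟨p, hp0, hp⟩ := exists_relation_of_multipliers F U G
  obtain ⟨q, hq0, hq⟩ := exists_relation_of_multipliers U F G
  refine ⟨p * rename (Equiv.swap 0 1) q, mul_ne_zero hp0 ?_, fun x hG hli hext => ?_⟩
  · rwa [Ne, map_eq_zero_iff _ (rename_injective _ (Equiv.injective _))]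
  · rw [map_mul, mul_eq_zero, eval_rename]
    refine (hext.exists_multipliers_of_linearIndependent hli).imp ?_ ?_
    · rintro ⟨c, μ, h⟩
      refine hp _ c μ hG fun j => ?_
      simpa [grad] using congrArg (fun v : EuclideanSpace ℝ (Fin n) => v j) h
    · rintro ⟨c, μ, h⟩
      have hswap : ∀ u v : ℝ, (![u, v] ∘ Equiv.swap 0 1 : Fin 2 → ℝ) = ![v, u] := fun u v => by
        funext i; fin_cases i <;> rfl
      rw [hswap]
      refine hq _ c μ hG fun j => ?_
      simpa [grad] using congrArg (fun v : EuclideanSpace ℝ (Fin n) => v j) h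

open MvPolynomial in
theorem exists_relation_of_isMinOn_sphere {n l m : ℕ} {f : EuclideanSpace ℝ (Fin n) → ℝ}
    {g : Fin l → EuclideanSpace ℝ (Fin n) → ℝ} {h : Fin m → EuclideanSpace ℝ (Fin n) → ℝ}
    (hf : IsPolyFun f) (hg : ∀ i, IsPolyFun (g i)) (hh : ∀ j, IsPolyFun (h j))
    (hlicq : LICQ g h) :
    ∃ p : MvPolynomial (Fin 2) ℝ, p ≠ 0 ∧ ∀ x ∈ conSet g h,
      IsMinOn f (conSet g h ∩ {y | ‖y‖ = ‖x‖}) x → eval ![‖x‖ ^ 2, f x] p = 0 := by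
  classical
  obtain ⟨F, hF⟩ := hf
  choose G hG using hg
  choose H hH using hh
  obtain rfl : f = _ := funext hF
  obtain rfl : g = _ := funext fun i => funext (hG i)
  obtain rfl : h = _ := funext fun j => funext (hH j)
  choose p hp0 hp using fun J : Set (Fin m) =>
    exists_relation_of_isLocalExtrOn F (normSq n) (Sum.elim G fun j : J => H j)
  refine ⟨∏ J, p J, Finset.prod_ne_zero_iff.2 fun J _ => hp0 J, fun x hx hmin => ?_⟩
  let J : Set (Fin m) := {j | eval (fun k => x k) (H j) = 0}
  rw [map_prod]
  refine Finset.prod_eq_zero (Finset.mem_univ J) ?_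
  have hact : ∀ i, eval (fun k => x k) ((Sum.elim G fun j : J => H j) i) = 0 := by
    rintro (i | j)
    · exact hx.1 i
    · exact j.2
  rw [← eval_normSq]
  refine hp J x hact ?_ ?_
  · have hli := hlicq x hx
    simp only [gradient_eval] at hli
    have hgrad : (fun i => (Sum.elim G (fun j : J => H j) i).grad x) =
        Sum.elim (fun i => (G i).grad x) fun j : J => (H j).grad x := by
      funext i
      rcases i with i | j <;> rfl
    rw [hgrad]
    exact hli
  · refine Or.inl ?_
    have hev : ∀ᶠ y in nhds x, ∀ j, j ∉ J → 0 < eval (fun k => y k) (H j) := by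
      refine Filter.eventually_all.2 fun j => ?_
      by_cases hj : j ∈ J
      · simp [hj]
      · have hpos : 0 < eval (fun k => x k) (H j) := lt_of_le_of_ne (hx.2 j) (Ne.symm hj)
        filter_upwards [(H j).continuous_eval_euclidean.continuousAt.eventually_const_lt hpos]
          with y hy _ using hy
    filter_upwards [nhdsWithin_le_nhds hev, self_mem_nhdsWithin] with y hy hyS
    refine hmin ⟨⟨fun i => ?_, fun j => ?_⟩, ?_⟩
    · exact (hyS.1 (Sum.inl i)).trans (hact _)
    · by_cases hj : j ∈ J
      · exact ((hyS.1 (Sum.inr ⟨j, hj⟩)).trans (hact _)).ge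
      · exact (hy j hj).le
    · have := hyS.2
      rw [eval_normSq, eval_normSq] at this
      exact (pow_left_inj₀ (norm_nonneg _) (norm_nonneg _) two_ne_zero).1 this

theorem CoerciveOn.exists_forall_le {n : ℕ} {f : EuclideanSpace ℝ (Fin n) → ℝ}
    {S : Set (EuclideanSpace ℝ (Fin n))} (hf : CoerciveOn f S) (M : ℝ) :
    ∃ R : ℝ, ∀ x ∈ S, R ≤ ‖x‖ → M ≤ f x := by
  by_contra! hcon
  choose x hxS hxR hxM using fun k : ℕ => hcon k
  obtain ⟨k, hk⟩ := ((hf x hxS (tendsto_atTop_mono hxR tendsto_natCast_atTop_atTop)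
    ).eventually_ge_atTop M).exists
  exact (hxM k).not_ge hk

/-- A coercive polynomial function on a regular basic closed semialgebraic set grows at least like
a positive power of the norm. -/
theorem CoerciveOn.exists_rpow_norm_le {n l m : ℕ} {f : EuclideanSpace ℝ (Fin n) → ℝ}
    {g : Fin l → EuclideanSpace ℝ (Fin n) → ℝ} {h : Fin m → EuclideanSpace ℝ (Fin n) → ℝ}
    (hf : IsPolyFun f) (hg : ∀ i, IsPolyFun (g i)) (hh : ∀ j, IsPolyFun (h j))
    (hlicq : LICQ g h) (hcoercive : CoerciveOn f (conSet g h)) :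
    ∃ (α R : ℝ), 0 < α ∧ ∀ x ∈ conSet g h, R ≤ ‖x‖ → ‖x‖ ^ α ≤ f x := by
  obtain ⟨p, hp0, hp⟩ := exists_relation_of_isMinOn_sphere hf hg hh hlicq
  obtain ⟨N, T, hN, hT, hNT⟩ := MvPolynomial.exists_pow_lt_of_eval_eq_zero hp0
  obtain ⟨R, hR⟩ := hcoercive.exists_forall_le T
  have hcont : ∀ {q : EuclideanSpace ℝ (Fin n) → ℝ}, IsPolyFun q → Continuous q := by
    rintro q ⟨Q, hQ⟩
    rw [funext hQ]
    exact Q.continuous_eval_euclidean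
  have hclosed : IsClosed (conSet g h) := by
    rw [conSet, Set.ofPred_and, Set.ofPred_forall, Set.ofPred_forall]
    exact (isClosed_iInter fun i => isClosed_eq (hcont (hg i)) continuous_const).inter
      (isClosed_iInter fun j => isClosed_le continuous_const (hcont (hh j)))
  refine ⟨2 / N, R, by positivity, fun x hx hxR => ?_⟩
  have hcompact : IsCompact (conSet g h ∩ {y | ‖y‖ = ‖x‖}) := by
    have : {y : EuclideanSpace ℝ (Fin n) | ‖y‖ = ‖x‖} = Metric.sphere 0 ‖x‖ := by
      ext y; simp
    rw [this]
    exact (isCompact_sphere _ _).inter_left hclosed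
  obtain ⟨y, ⟨hyS, hyx⟩, hy⟩ := hcompact.exists_isMinOn ⟨x, hx, rfl⟩ (hcont hf).continuousOn
  rw [Set.mem_ofPred_eq] at hyx
  have hTy : T ≤ f y := hR y hyS (hyx ▸ hxR)
  have hlt : ‖y‖ ^ 2 < f y ^ N := hNT _ _ hTy (hp y hyS (by rwa [hyx]))
  refine le_trans ?_ (hy ⟨hx, rfl⟩)
  rw [← hyx]
  have hfy : 0 ≤ f y := by linarith
  calc ‖y‖ ^ (2 / N : ℝ) = (‖y‖ ^ 2) ^ (1 / N : ℝ) := by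
        rw [← Real.rpow_natCast, ← Real.rpow_mul (norm_nonneg _)]
        congr 1
        push_cast
        ring
    _ ≤ (f y ^ N) ^ (1 / N : ℝ) := by gcongr
    _ = f y := by
        rw [one_div, Real.pow_rpow_inv_natCast hfy hN.ne']


theorem coercivity_stability {n l m : ℕ} (f : EuclideanSpace ℝ (Fin n) → ℝ)
    (g : Fin l → EuclideanSpace ℝ (Fin n) → ℝ) (h : Fin m → EuclideanSpace ℝ (Fin n) → ℝ)
    (hf : IsPolyFun f) (hg : ∀ i, IsPolyFun (g i)) (hh : ∀ j, IsPolyFun (h j))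
    (hS : (conSet g h).Nonempty) (hSu : ¬ Bornology.IsBounded (conSet g h))
    (hlicq : LICQ g h) (hcoercive : CoerciveOn f (conSet g h)) :
    ∃ ε : ℝ, 0 < ε ∧ ∃ α : ℝ, 0 < α ∧
      ∀ g0 : EuclideanSpace ℝ (Fin n) → ℝ, ContinuousOn g0 (conSet g h) →
        (∃ R' : ℝ, 0 < R' ∧ ∀ x ∈ conSet g h, R' ≤ ‖x‖ → |g0 x| ≤ ε * ‖x‖ ^ α) →
        CoerciveOn (fun x => f x + g0 x) (conSet g h) := by
  obtain ⟨α, R, hα, hR⟩ := hcoercive.exists_rpow_norm_le hf hg hh hlicq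
  refine ⟨1 / 2, by norm_num, α, hα, fun g0 _ ⟨R', _, hg0⟩ x hxS hx => ?_⟩
  refine tendsto_atTop_mono' _ ?_
    (((tendsto_rpow_atTop hα).comp hx).const_mul_atTop (by norm_num : (0 : ℝ) < 1 / 2))
  filter_upwards [hx.eventually_ge_atTop R, hx.eventually_ge_atTop R'] with k hk hk'
  have h1 := hR _ (hxS k) hk
  have h2 := (abs_le.1 (hg0 _ (hxS k) hk')).1
  simp only [Function.comp_apply]
  linarith
end
end
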